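/- Suppose q ≥ 4 is even and n ≥ 3. For every l with 2 ≤ l ≤ n−1, the subgroup of Sym(A^n) generated by all l-ary instructions is exactly the alternating group Alt(A^n). -/

import Mathlib

/-- An *`l`-ary instruction* on `A^n` is a permutation of `Fin n → A` which
changes at most one coordinate `j`, the new value of that coordinate
depending on at most `l` of the registers. -/
def IsLAryInstruction {n : ℕ} {A : Type*} (l : ℕ)
    (g : Equiv.Perm (Fin n → A)) : Prop :=
  ∃ j : Fin n, (∀ (x : Fin n → A) (i : Fin n), i ≠ j → g x i = x i) ∧
    ∃ S : Finset (Fin n), S.card ≤ l ∧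
      ∀ x y : Fin n → A, (∀ i ∈ S, x i = y i) → g x j = g y j

open Equiv Equiv.Perm MulAction
open scoped commutatorElement Pointwise

section ControlledPermutations

variable {ι A : Type*} [DecidableEq ι] [DecidableEq A]

/-- The permutation applying `σ` to register `j` of the states which agree with `p` on the
registers in `S` other than `j`. -/
def controlledPerm (j : ι) (S : Finset ι) (p : ι → A) : Perm A →* Perm (ι → A) :=
  MonoidHom.toHomPerm
    { toFun := fun σ x =>
        if ∀ i ∈ S, i ≠ j → x i = p i then Function.update x j (σ (x j)) else x
      map_one' := by
        funext x
        change (if _ then _ else _) = x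
        simp
      map_mul' := fun σ τ => by
        funext x
        change _ = (if _ then _ else _)
        by_cases h : ∀ i ∈ S, i ≠ j → x i = p i
        · have h' : ∀ i ∈ S, i ≠ j → Function.update x j (τ (x j)) i = p i := fun i hi hij => by
            rw [Function.update_of_ne hij, h i hi hij]
          simp only [if_pos h, if_pos h', Perm.mul_apply, Function.update_self,
            Function.update_idem]
        · simp only [if_neg h] }

theorem controlledPerm_apply (j : ι) (S : Finset ι) (p : ι → A) (σ : Perm A) (x : ι → A) :
    controlledPerm j S p σ x =
      if ∀ i ∈ S, i ≠ j → x i = p i then Function.update x j (σ (x j)) else x :=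
  rfl

theorem controlledPerm_apply_of_ne {j : ι} (S : Finset ι) (p : ι → A) (σ : Perm A) (x : ι → A)
    {i : ι} (hij : i ≠ j) : controlledPerm j S p σ x i = x i := by
  rw [controlledPerm_apply]
  split_ifs <;> simp [hij]

theorem controlledPerm_insert_commutator (j i : ι) (S : Finset ι) (p : ι → A) (τ σ : Perm A) :
    controlledPerm j (insert i S) p ⁅τ, σ⁆ =
      ⁅controlledPerm j {i} p τ, controlledPerm j S p σ⁆ := by
  ext1 x
  rw [commutatorElement_def, commutatorElement_def, ← map_inv, ← map_inv]
  simp only [Perm.mul_apply]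
  by_cases hi : i ≠ j → x i = p i <;> by_cases hS : ∀ k ∈ S, k ≠ j → x k = p k
  · have hi' (a : A) : i ≠ j → Function.update x j a i = p i := fun h => by
      rw [Function.update_of_ne h, hi h]
    have hS' (a : A) : ∀ k ∈ S, k ≠ j → Function.update x j a k = p k := fun k hk h => by
      rw [Function.update_of_ne h, hS k hk h]
    simp only [controlledPerm_apply, Finset.forall_mem_insert, Finset.mem_singleton, forall_eq,
      if_pos (hi' _), if_pos (hS' _), if_pos hS, if_pos (And.intro hi hS),
      Function.update_self, Function.update_idem, Perm.mul_apply]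
  · have hS' (a : A) : ¬ ∀ k ∈ S, k ≠ j → Function.update x j a k = p k := fun h =>
      hS fun k hk hkj => by rw [← h k hk hkj, Function.update_of_ne hkj]
    have hi' (a : A) : i ≠ j → Function.update x j a i = p i := fun h => by
      rw [Function.update_of_ne h, hi h]
    simp only [controlledPerm_apply, Finset.forall_mem_insert, Finset.mem_singleton, forall_eq,
      if_pos (hi' _), if_neg (hS' _), if_pos hi, hS, and_false, if_false,
      Function.update_self, Function.update_idem]
    simp
  · have hi' (a : A) : ¬ (i ≠ j → Function.update x j a i = p i) := fun h =>
      hi fun hij => by rw [← h hij, Function.update_of_ne hij]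
    have hS' (a : A) : ∀ k ∈ S, k ≠ j → Function.update x j a k = p k := fun k hk h => by
      rw [Function.update_of_ne h, hS k hk h]
    simp only [controlledPerm_apply, Finset.forall_mem_insert, Finset.mem_singleton, forall_eq,
      if_neg (hi' _), if_pos (hS' _), if_pos hS, hi, false_and, if_false,
      Function.update_self, Function.update_idem]
    simp
  · simp only [controlledPerm_apply, Finset.forall_mem_insert, Finset.mem_singleton, forall_eq,
      if_neg hS, hi, false_and, if_false]

theorem controlledPerm_univ_swap [Fintype ι] (j : ι) (p : ι → A) (a b : A) :
    controlledPerm j Finset.univ p (swap a b) =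
      swap (Function.update p j a) (Function.update p j b) := by
  have key (x : ι → A) (c : A) :
      x = Function.update p j c ↔ (∀ i ∈ Finset.univ, i ≠ j → x i = p i) ∧ x j = c := by
    rw [Function.eq_update_iff]
    simp [and_comm]
  ext1 x
  rw [controlledPerm_apply, swap_apply_def, swap_apply_def]
  simp only [key]
  by_cases h : ∀ i ∈ Finset.univ, i ≠ j → x i = p i
  · have hu (c : A) : Function.update x j c = Function.update p j c :=
      (key _ _).2 ⟨fun i hi hij => by rw [Function.update_of_ne hij, h i hi hij], by simp⟩
    rw [if_pos h]
    split_ifs <;> simp_all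
  · rw [if_neg h, if_neg fun h' => h h'.1, if_neg fun h' => h h'.1]

end ControlledPermutations

theorem commutator_swap_threeCycle {A : Type*} [DecidableEq A] {a b c : A}
    (hab : a ≠ b) (hac : a ≠ c) (hbc : b ≠ c) :
    ⁅swap a b, swap a b * swap a c⁆ = swap a b * swap a c := by
  ext x
  simp only [commutatorElement_def, mul_inv_rev, swap_inv, Perm.mul_apply]
  simp only [swap_apply_def]
  grind

section LineThreeCycles

theorem Set.eq_univ_of_update_mem {ι A : Type*} [Fintype ι] [DecidableEq ι] {B : Set (ι → A)} (hne : B.Nonempty)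
    (h : ∀ x ∈ B, ∀ j a, Function.update x j a ∈ B) : B = Set.univ := by
  obtain ⟨x, hx⟩ := hne
  refine Set.eq_univ_of_forall fun y => ?_
  have key (S : Finset ι) : S.piecewise y x ∈ B := by
    induction S using Finset.induction_on with
    | empty => simpa using hx
    | insert i S _ ih =>
      rw [Finset.piecewise_insert]
      exact h _ ih _ _
  simpa using key Finset.univ

variable {ι A : Type*} [Fintype ι] [DecidableEq ι] [Fintype A] [DecidableEq A]

/-- A group containing all `3`-cycles of collinear states contains the alternating group. -/
theorem alternatingGroup_le_of_collinear_threeCycles [Nonempty ι] (hA : 4 ≤ Fintype.card A)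
    (G : Subgroup (Perm (ι → A)))
    (hG : ∀ (j : ι) (p : ι → A) (a b c : A), a ≠ b → a ≠ c → b ≠ c →
      swap (Function.update p j a) (Function.update p j b) *
        swap (Function.update p j a) (Function.update p j c) ∈ G) :
    alternatingGroup (ι → A) ≤ G := by
  have avoid (s : Finset A) (hs : s.card ≤ 3) : ∃ d, d ∉ s := by
    by_contra! h
    have := Finset.card_le_card (fun x _ => h x : Finset.univ ⊆ s)
    rw [Finset.card_univ] at this
    omega
  have move (x y : ι → A) (j : ι) (a : A) (ha : a ≠ x j) (hy : y ≠ x)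
      (hya : y ≠ Function.update x j a) :
      ∃ g ∈ G, g x = Function.update x j a ∧ g y = y := by
    obtain ⟨d, hd⟩ := avoid {x j, a, y j} Finset.card_le_three
    simp only [Finset.mem_insert, Finset.mem_singleton, not_or] at hd
    obtain ⟨hdx, hda, hdy⟩ := hd
    have hinj := Function.update_injective x j
    have hxd : x ≠ Function.update x j d := fun h => hdx (by simpa using congrFun h.symm j)
    have had : Function.update x j a ≠ Function.update x j d := hinj.ne (Ne.symm hda)
    have hyd : y ≠ Function.update x j d := fun h => hdy (by simpa using congrFun h.symm j)
    refine ⟨_, hG j x a (x j) d ha (Ne.symm hda) (Ne.symm hdx), ?_, ?_⟩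
    · rw [Function.update_eq_self, Perm.mul_apply, swap_apply_of_ne_of_ne _ hxd,
        swap_apply_right]
      exact fun h => ha (by simpa using congrFun h.symm j)
    · rw [Function.update_eq_self, Perm.mul_apply, swap_apply_of_ne_of_ne hya hyd,
        swap_apply_of_ne_of_ne hya hy]
  have exists_ne (x z : ι → A) : ∃ y, y ≠ x ∧ y ≠ z := by
    obtain ⟨i⟩ := ‹Nonempty ι›
    obtain ⟨d, hd⟩ := avoid {x i, z i} (Finset.card_le_two.trans (by norm_num))
    simp only [Finset.mem_insert, Finset.mem_singleton, not_or] at hd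
    exact ⟨Function.update x i d, fun h => hd.1 (by simpa using congrFun h i),
      fun h => hd.2 (by simpa using congrFun h i)⟩
  have htrans : IsPretransitive G (ι → A) := by
    refine ⟨fun x y => ?_⟩
    have : orbit G x = Set.univ := by
      refine Set.eq_univ_of_update_mem ⟨x, mem_orbit_self x⟩ fun z hz j a => ?_
      by_cases ha : a = z j
      · rwa [ha, Function.update_eq_self]
      obtain ⟨y, hy, hya⟩ := exists_ne z (Function.update z j a)
      obtain ⟨g, hg, hgz, -⟩ := move z y j a ha hy hya
      rw [← hgz]
      exact mem_orbit_of_mem_orbit (⟨g, hg⟩ : G) hz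
    exact (this ▸ Set.mem_univ y : y ∈ orbit G x)
  have hprim : IsPreprimitive G (ι → A) := by
    refine ⟨fun {B} hB => or_iff_not_imp_left.2 fun hns => ?_⟩
    rw [Set.not_subsingleton_iff] at hns
    refine Set.eq_univ_of_update_mem hns.nonempty fun x hx j a => ?_
    by_contra hxa
    obtain ⟨y, hyB, hyx⟩ := hns.exists_ne x
    have ha : a ≠ x j := by
      rintro rfl
      rw [Function.update_eq_self] at hxa
      exact hxa hx
    obtain ⟨g, hg, hgx, hgy⟩ := move x y j a ha hyx fun h => hxa (h ▸ hyB)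
    have hgB : (⟨g, hg⟩ : G) • B = B := hB.smul_eq_of_mem hyB (by
      change g y ∈ B
      rwa [hgy])
    refine hxa ?_
    rw [← hgB, ← hgx]
    exact Set.smul_mem_smul_set (a := (⟨g, hg⟩ : G)) hx
  obtain ⟨j⟩ := ‹Nonempty ι›
  obtain ⟨a, -⟩ := avoid ∅ (by simp)
  obtain ⟨b, hb⟩ := avoid {a} (by simp)
  obtain ⟨c, hc⟩ := avoid {a, b} (Finset.card_le_two.trans (by norm_num))
  simp only [Finset.mem_insert, Finset.mem_singleton, not_or] at hb hc
  have hinj := Function.update_injective (fun _ : ι => a) j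
  exact alternatingGroup_le_of_isPreprimitive_of_isThreeCycle_mem hprim
    (isThreeCycle_swap_mul_swap_same (hinj.ne (Ne.symm hb)) (hinj.ne (Ne.symm hc.1))
      (hinj.ne (Ne.symm hc.2)))
    (hG j _ a b c (Ne.symm hb) (Ne.symm hc.1) (Ne.symm hc.2))

/-- A permutation fixing register `k` and acting on the others independently of it is even if
the alphabet has even size. -/
theorem sign_eq_one_of_ignores_register (hA : Even (Fintype.card A)) (g : Perm (ι → A)) (k : ι)
    (hk : ∀ x, g x k = x k)
    (hg : ∀ x y, (∀ i ≠ k, x i = y i) → ∀ i ≠ k, g x i = g y i) : sign g = 1 := by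
  cases isEmpty_or_nonempty A with
  | inl h =>
    have : IsEmpty (ι → A) := ⟨fun x => h.elim (x k)⟩
    rw [Subsingleton.elim g 1, Perm.sign_one]
  | inr h =>
    obtain ⟨a₀⟩ := h
    let e := funSplitAt k A
    let f : ({j // j ≠ k} → A) → ({j // j ≠ k} → A) := fun y => (e (g (e.symm (a₀, y)))).2
    have hf (x : ι → A) : f (e x).2 = (e (g x)).2 := by
      funext ⟨i, hi⟩
      refine hg _ _ (fun i hi => ?_) i hi
      simp [e, hi]
    have hinj : Function.Injective f := fun y z hyz => by
      have : e (g (e.symm (a₀, y))) = e (g (e.symm (a₀, z))) := by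
        refine Prod.ext ?_ hyz
        change g _ k = g _ k
        rw [hk, hk]
        simp [e]
      simpa using this
    let σ : Perm ({j // j ≠ k} → A) :=
      Equiv.ofBijective f (Finite.injective_iff_bijective.1 hinj)
    have : sign g = sign (prodCongrRight fun _ : A => σ) :=
      sign_eq_sign_of_equiv _ _ e fun x => by
        refine Prod.ext (hk x) ?_
        exact (hf x).symm
    rw [this, sign_prodCongrRight, Finset.prod_const, Finset.card_univ]
    obtain ⟨m, hm⟩ := hA
    rw [hm, pow_add, Int.units_mul_self]

end LineThreeCycles

theorem IsLAryInstruction.mono {n l m : ℕ} {A : Type*} {g : Perm (Fin n → A)}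
    (hg : IsLAryInstruction l g) (hlm : l ≤ m) : IsLAryInstruction m g := by
  obtain ⟨j, hj, S, hS, h⟩ := hg
  exact ⟨j, hj, S, hS.trans hlm, h⟩

theorem IsLAryInstruction.controlledPerm {n : ℕ} {A : Type*} [DecidableEq A] (j : Fin n)
    {S : Finset (Fin n)} (p : Fin n → A) (σ : Perm A) :
    IsLAryInstruction (S.card + 1) (controlledPerm j S p σ) := by
  refine ⟨j, fun x i hij => controlledPerm_apply_of_ne S p σ x hij, insert j S,
    Finset.card_insert_le _ _, fun x y h => ?_⟩
  rw [Finset.forall_mem_insert] at h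
  have : (∀ i ∈ S, i ≠ j → x i = p i) ↔ ∀ i ∈ S, i ≠ j → y i = p i :=
    forall₂_congr fun i hi => by rw [h.2 i hi]
  simp only [controlledPerm_apply, this]
  split_ifs <;> simp [h.1]

theorem IsLAryInstruction.sign_eq_one {n l : ℕ} {A : Type*} [Fintype A] [DecidableEq A]
    (heven : Even (Fintype.card A)) (hl : l < n) {g : Perm (Fin n → A)}
    (hg : IsLAryInstruction l g) : sign g = 1 := by
  obtain ⟨j, hj, S, hS, h⟩ := hg
  rcases subsingleton_or_nontrivial A with _ | _
  · rw [Subsingleton.elim g 1, Perm.sign_one]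
  have hjS : j ∈ S := by
    by_contra hjS
    obtain ⟨a, b, hab⟩ := exists_pair_ne A
    refine hab (Function.update_injective (fun _ => a) j (g.injective (funext fun i => ?_)))
    by_cases hij : i = j
    · subst hij
      refine h _ _ fun k hk => ?_
      have : k ≠ i := fun h => hjS (h ▸ hk)
      simp [this]
    · rw [hj _ _ hij, hj _ _ hij]
      simp [hij]
  obtain ⟨k, hk⟩ : ∃ k, k ∉ S := by
    by_contra! hall
    have := Finset.card_le_card (fun x _ => hall x : Finset.univ ⊆ S)
    rw [Finset.card_univ, Fintype.card_fin] at this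
    omega
  have hkj : k ≠ j := fun h => hk (h ▸ hjS)
  refine sign_eq_one_of_ignores_register heven g k (fun x => hj x k hkj) fun x y hxy i hi => ?_
  by_cases hij : i = j
  · subst hij
    exact h x y fun m hm => hxy m fun h => hk (h ▸ hm)
  · rw [hj _ _ hij, hj _ _ hij, hxy i hi]

/-- For even `q ≥ 4`, `n ≥ 3` and `2 ≤ l ≤ n - 1`, the `l`-ary instructions
generate exactly the alternating group `Alt(A^n)`. -/
theorem lary_instructions_generate_alternating_even
    (q n l : ℕ) (A : Type*) [Fintype A] [DecidableEq A]
    (hA : Fintype.card A = q) (hq : 4 ≤ q) (heven : Even q) (hn : 3 ≤ n)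
    (hl : 2 ≤ l) (hl' : l ≤ n - 1) :
    Subgroup.closure {g : Equiv.Perm (Fin n → A) | IsLAryInstruction l g} =
      alternatingGroup (Fin n → A) := by
  subst hA
  apply le_antisymm
  · rw [Subgroup.closure_le]
    intro g hg
    exact mem_alternatingGroup.2 (IsLAryInstruction.sign_eq_one heven (by omega) hg)
  · have : Nonempty (Fin n) := ⟨⟨0, by omega⟩⟩
    refine alternatingGroup_le_of_collinear_threeCycles hq _ fun j p a b c hab hac hbc => ?_
    have key (S : Finset (Fin n)) : controlledPerm j S p (swap a b * swap a c) ∈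
        Subgroup.closure {g : Perm (Fin n → A) | IsLAryInstruction l g} := by
      induction S using Finset.induction_on with
      | empty =>
        exact Subgroup.subset_closure
          ((IsLAryInstruction.controlledPerm j p _).mono (by simp; omega))
      | insert i S _ ih =>
        rw [← commutator_swap_threeCycle hab hac hbc, controlledPerm_insert_commutator]
        have hi : controlledPerm j {i} p (swap a b) ∈
            Subgroup.closure {g : Perm (Fin n → A) | IsLAryInstruction l g} :=
          Subgroup.subset_closure
            ((IsLAryInstruction.controlledPerm j p _).mono (by simpa using hl))
        rw [commutatorElement_def]
        exact mul_mem (mul_mem (mul_mem hi ih) (inv_mem hi)) (inv_mem ih)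
    simpa only [map_mul, controlledPerm_univ_swap] using key Finset.univ
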